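/- arXiv:2307.04839 — 2 statements merged into one kernel-verified Lean document; each statement's English description precedes it below -/
import Mathlib

section
/- For every n ∈ ℕ and every T ⊆ [n], the sequence (p^T_{n,0}(x), p^T_{n,1}(x), ..., p^T_{n,n}(x)) is an interlacing sequence of real-rooted polynomials; that is, each p^T_{n,k}(x) is real-rooted and p^T_{n,i}(x) interlaces p^T_{n,j}(x) whenever 0 ≤ i < j ≤ n. -/
open Polynomial

open scoped Classical

noncomputable section

/-- The descent set of a permutation `w` of `Fin n`, recorded as a subset of
`{1, ..., n-1}` (1-based positions, as in the paper: `i ∈ Des(w)` iff `w(i) > w(i+1)`). -/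
def descSet {n : ℕ} (w : Equiv.Perm (Fin n)) : Finset ℕ :=
  (Finset.univ.filter (fun i : Fin (n - 1) =>
      w ⟨i.val + 1, by have := i.isLt; omega⟩ < w ⟨i.val, by have := i.isLt; omega⟩)).image
    (fun i => i.val + 1)

/-- `A^T_n(x) = Σ_{w ∈ S_n, Des(w) ⊆ T} x^{des(w)}` (note `Des(w) ⊆ {1,...,n-1}`
automatically, so this also realizes the convention `A^T_n := A^{T ∩ [n-1]}_n`). -/
def Apoly (n : ℕ) (T : Finset ℕ) : Polynomial ℝ :=
  ∑ w ∈ Finset.univ.filter (fun w : Equiv.Perm (Fin n) => descSet w ⊆ T),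
    X ^ (descSet w).card

/-- `p^T_{n,k}(x) = Σ x^{des(w)}` over permutations `w ∈ S_{n+1}` with `w(1) = k+1`
(0-based: `w 0 = k`) and `Des(w) ⊆ T`. -/
def ppoly (n k : ℕ) (T : Finset ℕ) : Polynomial ℝ :=
  ∑ w ∈ Finset.univ.filter (fun w : Equiv.Perm (Fin (n + 1)) =>
      (w 0 : ℕ) = k ∧ descSet w ⊆ T),
    X ^ (descSet w).card

/-- A real polynomial has only real roots (or is identically zero). -/
def RealRooted (p : Polynomial ℝ) : Prop :=
  p = 0 ∨ ∀ z : ℂ, Polynomial.aeval z p = 0 → z.im = 0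

/-- The list of real roots of `p`, with multiplicity, in decreasing order. -/
def rootsDesc (p : Polynomial ℝ) : List ℝ :=
  (p.roots.sort (· ≤ ·)).reverse

/-- `Interlaces p q` means `p ⪯ q`: both are real-rooted and, listing the roots of `p`
as `α_1 ≥ α_2 ≥ ⋯` and those of `q` as `β_1 ≥ β_2 ≥ ⋯`, one has
`⋯ ≤ α_2 ≤ β_2 ≤ α_1 ≤ β_1`; by convention the zero polynomial interlaces and is
interlaced by every real-rooted polynomial. -/
def Interlaces (p q : Polynomial ℝ) : Prop :=
  (p = 0 ∧ RealRooted q) ∨ (q = 0 ∧ RealRooted p) ∨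
  (RealRooted p ∧ RealRooted q ∧
    Multiset.card q.roots ≤ Multiset.card p.roots + 1 ∧
    Multiset.card p.roots ≤ Multiset.card q.roots ∧
    (∀ (i : ℕ) (hp : i < (rootsDesc p).length) (hq : i < (rootsDesc q).length),
      (rootsDesc p).get ⟨i, hp⟩ ≤ (rootsDesc q).get ⟨i, hq⟩) ∧
    (∀ (i : ℕ) (hq : i + 1 < (rootsDesc q).length) (hp : i < (rootsDesc p).length),
      (rootsDesc q).get ⟨i + 1, hq⟩ ≤ (rootsDesc p).get ⟨i, hp⟩))


/-- The bilinear form of interlacing at a point `z` of the upper half plane. -/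
def MM (z u v : ℂ) : Prop :=
  0 ≤ (v * (starRingEnd ℂ) u).im ∧ 0 ≤ (z * u * (starRingEnd ℂ) v).im

lemma MM_sum {ι κ : Type*} (z : ℂ) (s : Finset ι) (t : Finset κ) (u : ι → ℂ) (v : κ → ℂ)
    (h : ∀ i ∈ s, ∀ j ∈ t, MM z (u i) (v j)) : MM z (∑ i ∈ s, u i) (∑ j ∈ t, v j) := by
  constructor
  · rw [map_sum, Finset.sum_mul_sum, Complex.im_sum]
    refine Finset.sum_nonneg fun j hj => ?_
    rw [Complex.im_sum]
    exact Finset.sum_nonneg fun i hi => (h i hi j hj).1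
  · rw [map_sum, Finset.mul_sum s u z, Finset.sum_mul_sum, Complex.im_sum]
    refine Finset.sum_nonneg fun j hj => ?_
    rw [Complex.im_sum]
    exact Finset.sum_nonneg fun i hi => (h j hj i hi).2

lemma MM_step1 {z A B C : ℂ} (hz : 0 < z.im) (hAB : MM z A B) (hAC : MM z A C) (hBC : MM z B C) :
    MM z (z * A + (B + C)) (z * (A + B) + C) := by
  obtain ⟨h1, h2⟩ := hAB
  obtain ⟨h3, h4⟩ := hAC
  obtain ⟨h5, h6⟩ := hBC
  have hn : 0 ≤ z.re ^ 2 + z.im ^ 2 := by positivity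
  constructor
  · have e : ((z * (A + B) + C) * (starRingEnd ℂ) (z * A + (B + C))).im
        = (z * A * (starRingEnd ℂ) B).im + (z.re ^ 2 + z.im ^ 2) * (B * (starRingEnd ℂ) A).im
          + z.im * (B.re ^ 2 + B.im ^ 2) + (z * B * (starRingEnd ℂ) C).im
          + (C * (starRingEnd ℂ) B).im := by
      simp only [Complex.mul_im, Complex.mul_re, Complex.add_im, Complex.add_re, map_add, map_mul,
        Complex.conj_re, Complex.conj_im]
      ring
    rw [e]
    have := mul_nonneg hn h1
    positivity
  · have e : (z * (z * A + (B + C)) * (starRingEnd ℂ) (z * (A + B) + C)).im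
        = z.im * ((z * A + C).re ^ 2 + (z * A + C).im ^ 2)
          + (z.re ^ 2 + z.im ^ 2) * (z * A * (starRingEnd ℂ) B).im
          + (z.re ^ 2 + z.im ^ 2) * (B * (starRingEnd ℂ) A).im
          + (z * B * (starRingEnd ℂ) C).im
          + (z.re ^ 2 + z.im ^ 2) * (C * (starRingEnd ℂ) B).im := by
      simp only [Complex.mul_im, Complex.mul_re, Complex.add_im, Complex.add_re, map_add, map_mul,
        Complex.conj_re, Complex.conj_im]
      ring
    rw [e]
    have := mul_nonneg hn h1
    have := mul_nonneg hn h2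
    have := mul_nonneg hn h5
    positivity

lemma MM_step0 {z B C : ℂ} (hz : 0 < z.im) (hBC : MM z B C) :
    MM z (B + C) C := by
  obtain ⟨h5, h6⟩ := hBC
  constructor
  · have e : (C * (starRingEnd ℂ) (B + C)).im = (C * (starRingEnd ℂ) B).im := by
      simp only [Complex.mul_im, Complex.add_im, Complex.add_re, map_add,
        Complex.conj_re, Complex.conj_im]
      ring
    rw [e]; exact h5
  · have e : (z * (B + C) * (starRingEnd ℂ) C).im
        = (z * B * (starRingEnd ℂ) C).im + z.im * (C.re ^ 2 + C.im ^ 2) := by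
      simp only [Complex.mul_im, Complex.mul_re, Complex.add_im, Complex.add_re,
        Complex.conj_re, Complex.conj_im]
      ring
    rw [e]; positivity

lemma MM_zero {z u v : ℂ} (hz : 0 < z.im) (h : MM z u v) (h0 : u + v = 0) : u = 0 ∧ v = 0 := by
  have hv : v = -u := by linear_combination h0
  subst hv
  have h2 := h.2
  have e : (z * u * (starRingEnd ℂ) (-u)).im = -(z.im * (u.re ^ 2 + u.im ^ 2)) := by
    simp only [Complex.mul_im, Complex.mul_re, map_neg, Complex.neg_re, Complex.neg_im,
        Complex.conj_re, Complex.conj_im]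
    ring
  rw [e] at h2
  have h3 : u.re ^ 2 + u.im ^ 2 = 0 := by
    by_contra hne
    have : 0 < u.re ^ 2 + u.im ^ 2 := lt_of_le_of_ne (by positivity) (Ne.symm hne)
    have := mul_pos hz this
    linarith
  have hr : u.re = 0 := by nlinarith [sq_nonneg u.re, sq_nonneg u.im]
  have hi : u.im = 0 := by nlinarith [sq_nonneg u.re, sq_nonneg u.im]
  have : u = 0 := Complex.ext hr hi
  simp [this]

lemma MM_rot {z A C : ℂ} (h : MM z A C) : MM z C (z * A) := by
  refine ⟨h.2, ?_⟩
  have e : (z * C * (starRingEnd ℂ) (z * A)).im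
      = (z.re ^ 2 + z.im ^ 2) * (C * (starRingEnd ℂ) A).im := by
    simp only [Complex.mul_im, Complex.mul_re, map_mul, Complex.conj_re, Complex.conj_im]
    ring
  rw [e]
  exact mul_nonneg (by positivity) h.1

lemma MM_sum_zero {z : ℂ} (hz : 0 < z.im) (u : ℕ → ℂ) (N : ℕ)
    (h : ∀ i j, i < j → j < N → MM z (u i) (u j)) (s : Finset ℕ) (hs : ∀ i ∈ s, i < N)
    (h0 : ∑ i ∈ s, u i = 0) : ∀ i ∈ s, u i = 0 := by
  induction s using Finset.induction_on_max with
  | empty => simp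
  | insert a s ha ih =>
    have hna : a ∉ s := fun hh => lt_irrefl _ (ha a hh)
    rw [Finset.sum_insert hna] at h0
    have key : MM z (∑ i ∈ s, u i) (∑ j ∈ {a}, u j) := by
      apply MM_sum
      intro i hi j hj
      rw [Finset.mem_singleton] at hj
      subst hj
      exact h i j (ha i hi) (hs j (Finset.mem_insert_self _ _))
    rw [Finset.sum_singleton] at key
    obtain ⟨h1, h2⟩ := MM_zero hz key (by rw [add_comm]; exact h0)
    intro i hi
    rcases Finset.mem_insert.1 hi with rfl | hi
    · exact h2
    · exact ih (fun i hi => hs i (Finset.mem_insert_of_mem hi)) h1 i hi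

/-- Insert a first letter `k` in front of a permutation (with standardization). -/
def extPerm {n : ℕ} (k : Fin (n + 2)) (w : Equiv.Perm (Fin (n + 1))) : Equiv.Perm (Fin (n + 2)) :=
  ((finSuccEquiv' 0).trans (Equiv.optionCongr w)).trans (finSuccEquiv' k).symm

lemma extPerm_zero {n : ℕ} (k : Fin (n + 2)) (w : Equiv.Perm (Fin (n + 1))) :
    extPerm k w 0 = k := by
  simp [extPerm]

lemma extPerm_succ {n : ℕ} (k : Fin (n + 2)) (w : Equiv.Perm (Fin (n + 1))) (i : Fin (n + 1)) :
    extPerm k w i.succ = k.succAbove (w i) := by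
  have h : finSuccEquiv' (0 : Fin (n + 2)) i.succ = some i := by
    have := finSuccEquiv'_succAbove (0 : Fin (n + 2)) i
    rwa [Fin.succAbove_zero] at this
  simp [extPerm, h]

lemma extPerm_surj {n : ℕ} (v : Equiv.Perm (Fin (n + 2))) : ∃ w, extPerm (v 0) w = v := by
  let e : Option (Fin (n + 1)) ≃ Option (Fin (n + 1)) :=
    ((finSuccEquiv' 0).symm.trans v).trans (finSuccEquiv' (v 0))
  have he : e none = none := by simp [e]
  refine ⟨Equiv.removeNone e, ?_⟩
  ext1 i
  refine Fin.cases ?_ (fun i => ?_) i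
  · rw [extPerm_zero]
  · rw [extPerm_succ]
    have h : ∃ x', e (some i) = some x' := by
      rw [← Option.ne_none_iff_exists']
      intro hh
      have := e.injective (hh.trans he.symm)
      simp at this
    have h2 := Equiv.removeNone_some e h
    have h3 : e (some i) = finSuccEquiv' (v 0) (v i.succ) := by simp [e]
    rw [h3] at h2
    have := finSuccEquiv'_eq_some.1 h2.symm
    exact this.symm

lemma extPerm_inj {n : ℕ} (k : Fin (n + 2)) : Function.Injective (extPerm k) := by
  intro w w' h
  ext1 i
  have := congrArg (fun v => v i.succ) h
  simp only [extPerm_succ] at this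
  exact Fin.succAbove_right_injective this

lemma mem_descSet {n : ℕ} (w : Equiv.Perm (Fin (n + 1))) (a : ℕ) :
    a + 1 ∈ descSet w ↔ ∃ h : a < n, w (Fin.succ ⟨a, h⟩) < w (Fin.castSucc ⟨a, h⟩) := by
  unfold descSet
  simp only [Finset.mem_image, Finset.mem_filter, Finset.mem_univ, true_and]
  constructor
  · rintro ⟨i, hi, hia⟩
    have : i.val = a := by omega
    subst this
    exact ⟨i.isLt, hi⟩
  · rintro ⟨h, hw⟩
    exact ⟨⟨a, h⟩, hw, rfl⟩

lemma zero_notMem_descSet {n : ℕ} (w : Equiv.Perm (Fin n)) : 0 ∉ descSet w := by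
  unfold descSet; simp

lemma descSet_extPerm {n : ℕ} (k : Fin (n + 2)) (w : Equiv.Perm (Fin (n + 1))) :
    descSet (extPerm k w) = (if (w 0 : ℕ) < k then {1} else ∅) ∪ (descSet w).image (· + 1) := by
  ext a
  rcases a with _ | a
  · have := zero_notMem_descSet (extPerm k w)
    simp only [this, false_iff]
    split_ifs <;> simp
  rw [mem_descSet]
  rcases a with _ | a
  · have h0 : (0 : ℕ) < n + 1 := by omega
    have e1 : extPerm k w (Fin.succ ⟨0, h0⟩) = k.succAbove (w 0) := extPerm_succ k w 0
    have e2 : extPerm k w (Fin.castSucc ⟨0, h0⟩) = k := extPerm_zero k w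
    have e3 : k.succAbove (w 0) < k ↔ (w 0 : ℕ) < k := by
      rw [Fin.succAbove_lt_iff_castSucc_lt, Fin.lt_def, Fin.val_castSucc]
    simp only [e1, e2, e3]
    have := zero_notMem_descSet w
    split_ifs with h
    · simp [h]
    · simp [h, this]
  · have : a + 1 + 1 ∈ (if (w 0 : ℕ) < k then {1} else ∅) ∪ (descSet w).image (· + 1)
        ↔ a + 1 ∈ descSet w := by
      split_ifs <;> simp
    rw [this, mem_descSet]
    constructor
    · rintro ⟨h, hw⟩
      have h' : a < n := by omega
      refine ⟨h', ?_⟩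
      have e1 : extPerm k w (Fin.succ ⟨a + 1, h⟩) = k.succAbove (w (Fin.succ ⟨a, h'⟩)) :=
        extPerm_succ k w _
      have e2 : extPerm k w (Fin.castSucc ⟨a + 1, h⟩) = k.succAbove (w (Fin.castSucc ⟨a, h'⟩)) :=
        extPerm_succ k w (Fin.castSucc ⟨a, h'⟩)
      rw [e1, e2] at hw
      exact (Fin.strictMono_succAbove k).lt_iff_lt.1 hw
    · rintro ⟨h', hw⟩
      have h : a + 1 < n + 1 := by omega
      refine ⟨h, ?_⟩
      have e1 : extPerm k w (Fin.succ ⟨a + 1, h⟩) = k.succAbove (w (Fin.succ ⟨a, h'⟩)) :=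
        extPerm_succ k w _
      have e2 : extPerm k w (Fin.castSucc ⟨a + 1, h⟩) = k.succAbove (w (Fin.castSucc ⟨a, h'⟩)) :=
        extPerm_succ k w (Fin.castSucc ⟨a, h'⟩)
      rw [e1, e2]
      exact (Fin.strictMono_succAbove k).lt_iff_lt.2 hw

/-- The shifted set `{i : i + 1 ∈ T}`. -/
def shiftSet (T : Finset ℕ) : Finset ℕ := T.preimage (· + 1) ((add_left_injective 1).injOn)

lemma descSet_extPerm_sub {n : ℕ} (k : Fin (n + 2)) (w : Equiv.Perm (Fin (n + 1)))
    (T : Finset ℕ) : descSet (extPerm k w) ⊆ T ↔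
      ((w 0 : ℕ) < k → 1 ∈ T) ∧ descSet w ⊆ shiftSet T := by
  rw [descSet_extPerm, Finset.union_subset_iff]
  refine and_congr ?_ ?_
  · split_ifs with h <;> simp [h]
  · rw [Finset.image_subset_iff]
    exact forall₂_congr fun x _ => by rw [shiftSet, Finset.mem_preimage]

lemma descSet_extPerm_card {n : ℕ} (k : Fin (n + 2)) (w : Equiv.Perm (Fin (n + 1))) :
    (descSet (extPerm k w)).card = (if (w 0 : ℕ) < k then 1 else 0) + (descSet w).card := by
  rw [descSet_extPerm, Finset.card_union_of_disjoint]
  · congr 1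
    · split_ifs <;> simp
    · exact Finset.card_image_of_injective _ (add_left_injective 1)
  · have := zero_notMem_descSet w
    split_ifs <;> simp [this]

lemma ppoly_succ (n k : ℕ) (hk : k ≤ n + 1) (T : Finset ℕ) :
    ppoly (n + 1) k T = ∑ j ∈ Finset.range (n + 1),
      (if j < k then (if 1 ∈ T then X else 0) else 1) * ppoly n j (shiftSet T) := by
  have h1 : ppoly (n + 1) k T = ∑ w : Equiv.Perm (Fin (n + 1)),
      (if descSet w ⊆ shiftSet T then
        (if (w 0 : ℕ) < k then (if 1 ∈ T then X else 0) else 1) * X ^ (descSet w).card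
        else 0) := by
    unfold ppoly
    have hset : Finset.univ.filter (fun w : Equiv.Perm (Fin (n + 1 + 1)) =>
        (w 0 : ℕ) = k ∧ descSet w ⊆ T) =
        (Finset.univ.filter (fun w : Equiv.Perm (Fin (n + 1)) =>
          ((w 0 : ℕ) < k → 1 ∈ T) ∧ descSet w ⊆ shiftSet T)).image
          (extPerm ⟨k, by omega⟩) := by
      ext v
      simp only [Finset.mem_image, Finset.mem_filter, Finset.mem_univ, true_and]
      constructor
      · rintro ⟨h0, hs⟩
        obtain ⟨w, hw⟩ := extPerm_surj v
        have hv : v 0 = ⟨k, by omega⟩ := Fin.ext h0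
        rw [hv] at hw
        refine ⟨w, ?_, hw⟩
        rw [← hw] at hs
        exact (descSet_extPerm_sub _ _ _).1 hs
      · rintro ⟨w, hw, rfl⟩
        exact ⟨by rw [extPerm_zero], (descSet_extPerm_sub _ _ _).2 hw⟩
    rw [hset, Finset.sum_image (fun a _ b _ h => extPerm_inj _ h), Finset.sum_filter]
    refine Finset.sum_congr rfl fun w _ => ?_
    rw [descSet_extPerm_card]
    by_cases ha : (w 0 : ℕ) < k <;> by_cases hb : 1 ∈ T <;>
      by_cases hc : descSet w ⊆ shiftSet T <;> simp [ha, hb, hc, pow_add]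
  rw [h1]
  have h2 : ∀ j, ppoly n j (shiftSet T) = ∑ w : Equiv.Perm (Fin (n + 1)),
      (if (w 0 : ℕ) = j then (if descSet w ⊆ shiftSet T then X ^ (descSet w).card else 0)
        else 0) := by
    intro j
    unfold ppoly
    rw [Finset.sum_filter]
    refine Finset.sum_congr rfl fun w _ => ?_
    by_cases ha : (w 0 : ℕ) = j <;> by_cases hc : descSet w ⊆ shiftSet T <;> simp [ha, hc]
  simp_rw [h2, Finset.mul_sum]
  rw [Finset.sum_comm]
  refine Finset.sum_congr rfl fun w _ => ?_
  simp_rw [mul_ite, mul_zero]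
  rw [Finset.sum_ite_eq, if_pos (Finset.mem_range.2 (w 0).isLt)]

lemma ppoly_coeff_nonneg (n k : ℕ) (T : Finset ℕ) (i : ℕ) : 0 ≤ (ppoly n k T).coeff i := by
  unfold ppoly
  rw [finsetSum_coeff]
  refine Finset.sum_nonneg fun w _ => ?_
  rw [coeff_X_pow]
  split_ifs <;> norm_num

lemma ppoly_main (n : ℕ) : ∀ (T : Finset ℕ) (z : ℂ), 0 < z.im →
    (∀ k ≤ n, aeval z (ppoly n k T) = 0 → ppoly n k T = 0) ∧
    (∀ i j, i < j → j < n + 1 → MM z (aeval z (ppoly n i T)) (aeval z (ppoly n j T))) := by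
  induction n with
  | zero =>
    intro T z hz
    refine ⟨?_, fun i j h1 h2 => by omega⟩
    intro k hk h
    have e : ∀ w : Equiv.Perm (Fin (0 + 1)), descSet w = ∅ := by
      intro w; unfold descSet; simp
    unfold ppoly at h ⊢
    simp only [e, Finset.card_empty, pow_zero, Finset.sum_const] at h ⊢
    simpa using h
  | succ n ih =>
    intro T z hz
    obtain ⟨ih1, ih2⟩ := ih (shiftSet T) z hz
    set f : ℕ → ℂ := fun j => aeval z (ppoly n j (shiftSet T)) with hf
    have hrec : ∀ k ≤ n + 1, aeval z (ppoly (n + 1) k T) =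
        (if 1 ∈ T then z else 0) * (∑ j ∈ Finset.Ico 0 k, f j) + ∑ j ∈ Finset.Ico k (n + 1), f j := by
      intro k hk
      rw [ppoly_succ n k hk, map_sum, Finset.range_eq_Ico,
        ← Finset.sum_Ico_consecutive _ (Nat.zero_le k) hk, Finset.mul_sum]
      congr 1
      · refine Finset.sum_congr rfl fun j hj => ?_
        have := (Finset.mem_Ico.1 hj).2
        by_cases hT : 1 ∈ T <;> simp [this, hT, hf]
      · refine Finset.sum_congr rfl fun j hj => ?_
        have := (Finset.mem_Ico.1 hj).1
        simp [not_lt.2 this, hf]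
    have hM : ∀ a b c d, b ≤ c → d ≤ n + 1 →
        MM z (∑ j ∈ Finset.Ico a b, f j) (∑ j ∈ Finset.Ico c d, f j) := by
      intro a b c d hbc hd
      refine MM_sum _ _ _ _ _ fun i hi j hj => ?_
      have hi := Finset.mem_Ico.1 hi
      have hj := Finset.mem_Ico.1 hj
      exact ih2 i j (by omega) (by omega)
    have hZ : ∀ a b, b ≤ n + 1 → ∑ j ∈ Finset.Ico a b, f j = 0 →
        ∀ j ∈ Finset.Ico a b, ppoly n j (shiftSet T) = 0 := by
      intro a b hb h0 j hj
      have := MM_sum_zero hz f (n + 1) ih2 (Finset.Ico a b)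
        (fun i hi => by have := Finset.mem_Ico.1 hi; omega) h0 j hj
      exact ih1 j (by have := Finset.mem_Ico.1 hj; omega) this
    refine ⟨?_, ?_⟩
    · intro k hk h0
      rw [hrec k hk] at h0
      rw [ppoly_succ n k hk]
      refine Finset.sum_eq_zero fun j hj => ?_
      have hj := Finset.mem_range.1 hj
      by_cases hT : 1 ∈ T
      · simp only [hT, if_true] at h0
        obtain ⟨h1, h2⟩ := MM_zero hz (MM_rot (hM 0 k k (n + 1) le_rfl le_rfl))
          (by rw [add_comm]; exact h0)
        have hz0 : z ≠ 0 := by rintro rfl; simp at hz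
        have h2 := (mul_eq_zero.1 h2).resolve_left hz0
        by_cases hjk : j < k
        · rw [hZ 0 k hk h2 j (Finset.mem_Ico.2 ⟨by omega, hjk⟩), mul_zero]
        · rw [hZ k (n + 1) le_rfl h1 j (Finset.mem_Ico.2 ⟨by omega, hj⟩), mul_zero]
      · simp only [hT, if_false, zero_mul, zero_add] at h0
        by_cases hjk : j < k
        · simp [hjk, hT]
        · rw [hZ k (n + 1) le_rfl h0 j (Finset.mem_Ico.2 ⟨by omega, hj⟩), mul_zero]
    · intro i j hij hj
      rw [hrec i (by omega), hrec j (by omega),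
        ← Finset.sum_Ico_consecutive f (Nat.zero_le i) hij.le,
        ← Finset.sum_Ico_consecutive f hij.le (show j ≤ n + 1 by omega)]
      by_cases hT : 1 ∈ T
      · simp only [hT, if_true]
        exact MM_step1 hz (hM _ _ _ _ le_rfl (by omega)) (hM _ _ _ _ hij.le le_rfl)
          (hM _ _ _ _ le_rfl le_rfl)
      · simp only [hT, if_false, zero_mul, zero_add]
        exact MM_step0 hz (hM _ _ _ _ le_rfl le_rfl)

/-- The argument of `x + i e` for `e > 0`. -/
def ang (x e : ℝ) : ℝ := Real.pi / 2 - Real.arctan (x / e)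

lemma ang_spec (x e : ℝ) (he : 0 < e) :
    ∃ r : ℝ, 0 < r ∧ (x : ℂ) + e * Complex.I = r * Complex.exp (ang x e * Complex.I) := by
  have hs : 0 < √(1 + (x / e) ^ 2) := by positivity
  refine ⟨e * √(1 + (x / e) ^ 2), by positivity, ?_⟩
  rw [Complex.exp_mul_I, ← Complex.ofReal_cos, ← Complex.ofReal_sin]
  have h1 : Real.cos (ang x e) = (x / e) / √(1 + (x / e) ^ 2) := by
    rw [ang, Real.cos_pi_div_two_sub, Real.sin_arctan]
  have h2 : Real.sin (ang x e) = 1 / √(1 + (x / e) ^ 2) := by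
    rw [ang, Real.sin_pi_div_two_sub, Real.cos_arctan]
  have h3 : e * √(1 + (x / e) ^ 2) * Real.cos (ang x e) = x := by
    rw [h1]; field_simp
  have h4 : e * √(1 + (x / e) ^ 2) * Real.sin (ang x e) = e := by
    rw [h2]; field_simp
  rw [mul_add, ← mul_assoc, ← Complex.ofReal_mul, ← Complex.ofReal_mul, h3, h4]

/-- Total argument of `∏ (t + i e - a)`. -/
def th (R : Multiset ℝ) (t e : ℝ) : ℝ := (R.map fun a => ang (t - a) e).sum

lemma th_cons (a : ℝ) (R : Multiset ℝ) (t e : ℝ) : th (a ::ₘ R) t e = ang (t - a) e + th R t e := by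
  simp [th]

lemma th_spec (R : Multiset ℝ) (t e : ℝ) (he : 0 < e) :
    ∃ r : ℝ, 0 < r ∧ (R.map fun a : ℝ => ((t : ℂ) + e * Complex.I) - (a : ℂ)).prod
      = r * Complex.exp (th R t e * Complex.I) := by
  induction R using Multiset.induction with
  | empty => exact ⟨1, one_pos, by simp [th]⟩
  | cons a R ih =>
    obtain ⟨r, hr, h⟩ := ih
    obtain ⟨s, hs, h'⟩ := ang_spec (t - a) e he
    refine ⟨s * r, mul_pos hs hr, ?_⟩
    rw [Multiset.map_cons, Multiset.prod_cons, h, th_cons]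
    have : (t : ℂ) + e * Complex.I - a = ((t - a : ℝ) : ℂ) + e * Complex.I := by push_cast; ring
    rw [this, h']
    push_cast
    rw [add_mul, Complex.exp_add]
    ring

lemma th_cont (R : Multiset ℝ) (e : ℝ) : Continuous fun t => th R t e := by
  induction R using Multiset.induction with
  | empty => simp only [th, Multiset.map_zero, Multiset.sum_zero]; fun_prop
  | cons a R ih =>
    simp only [th_cons]
    refine Continuous.add ?_ ih
    unfold ang
    exact continuous_const.sub (Real.continuous_arctan.comp (by fun_prop))

open Filter Topology in
lemma th_top (R : Multiset ℝ) (e : ℝ) (he : 0 < e) : Tendsto (fun t => th R t e) atTop (𝓝 0) := by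
  induction R using Multiset.induction with
  | empty => simp only [th, Multiset.map_zero, Multiset.sum_zero]; exact tendsto_const_nhds
  | cons a R ih =>
    simp only [th_cons]
    have h1 : Tendsto (fun t => ang (t - a) e) atTop (𝓝 0) := by
      have h2 : Tendsto (fun t : ℝ => (t - a) / e) atTop atTop :=
        (tendsto_atTop_add_const_right atTop (-a) tendsto_id).atTop_div_const he
      have h3 := (Real.tendsto_arctan_atTop.mono_right nhdsWithin_le_nhds).comp h2
      have h4 := h3.const_sub (Real.pi / 2)
      rw [sub_self] at h4
      exact h4
    simpa using h1.add ih

open Filter Topology in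
lemma th_zero (R : Multiset ℝ) (t : ℝ) (ht : t ∉ R) :
    Tendsto (fun e => th R t e) (𝓝[>] 0) (𝓝 (Multiset.countP (fun a => t < a) R * Real.pi)) := by
  induction R using Multiset.induction with
  | empty => simp only [th, Multiset.map_zero, Multiset.sum_zero]; simp
  | cons a R ih =>
    simp only [th_cons]
    rw [Multiset.mem_cons, not_or] at ht
    have ih := ih ht.2
    have hinv : Tendsto (fun e : ℝ => e⁻¹) (𝓝[>] 0) atTop := tendsto_inv_nhdsGT_zero
    rcases lt_or_gt_of_ne ht.1 with h | h
    · rw [Multiset.countP_cons_of_pos (p := fun a => t < a) _ h]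
      have h2 : Tendsto (fun e : ℝ => (t - a) / e) (𝓝[>] 0) atBot := by
        simp only [div_eq_mul_inv]
        exact hinv.const_mul_atTop_of_neg (by linarith)
      have h3 := (Real.tendsto_arctan_atBot.mono_right nhdsWithin_le_nhds).comp h2
      have h4 := (h3.const_sub (Real.pi / 2)).add ih
      have e : ((Multiset.countP (fun a => t < a) R + 1 : ℕ) : ℝ) * Real.pi
          = Real.pi / 2 - -(Real.pi / 2) + Multiset.countP (fun a => t < a) R * Real.pi := by
        push_cast; ring
      rw [e]
      exact h4
    · rw [Multiset.countP_cons_of_neg (p := fun a => t < a) _ (by exact not_lt.2 h.le)]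
      have h2 : Tendsto (fun e : ℝ => (t - a) / e) (𝓝[>] 0) atTop := by
        simp only [div_eq_mul_inv]
        exact hinv.const_mul_atTop (by linarith)
      have h3 := (Real.tendsto_arctan_atTop.mono_right nhdsWithin_le_nhds).comp h2
      have h4 := (h3.const_sub (Real.pi / 2)).add ih
      rw [sub_self, zero_add] at h4
      exact h4

open Filter Topology in
lemma sin_conn (f : ℝ → ℝ) (hf : Continuous f) (h0 : Tendsto f atTop (𝓝 0))
    (hs : ∀ t, 0 ≤ Real.sin (f t)) (t : ℝ) : 0 ≤ f t ∧ f t ≤ Real.pi := by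
  have hpi := Real.pi_pos
  obtain ⟨s, hs1, hs2⟩ : ∃ s, -(Real.pi / 2) < f s ∧ f s < Real.pi / 2 := by
    have := h0.eventually (Ioo_mem_nhds (show -(Real.pi / 2) < 0 by linarith)
      (show 0 < Real.pi / 2 by linarith))
    obtain ⟨s, hs⟩ := this.exists
    exact ⟨s, hs.1, hs.2⟩
  have ivt : ∀ y ∈ Set.uIcc (f s) (f t), ∃ x, f x = y := by
    intro y hy
    obtain ⟨x, -, hx⟩ := intermediate_value_uIcc (hf.continuousOn (s := Set.uIcc s t)) hy
    exact ⟨x, hx⟩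
  constructor
  · by_contra hlt
    push Not at hlt
    by_cases h : -(Real.pi / 2) < f t
    · have := Real.sin_neg_of_neg_of_neg_pi_lt hlt (by linarith)
      linarith [hs t]
    · obtain ⟨x, hx⟩ := ivt (-(Real.pi / 2)) (Set.mem_uIcc.2 (Or.inr ⟨by linarith, by linarith⟩))
      have := hs x
      rw [hx, Real.sin_neg, Real.sin_pi_div_two] at this
      linarith
  · by_contra hlt
    push Not at hlt
    by_cases h : f t < 3 * Real.pi / 2
    · have h1 : Real.sin (f t - Real.pi) > 0 :=
        Real.sin_pos_of_pos_of_lt_pi (by linarith) (by linarith)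
      rw [Real.sin_sub_pi] at h1
      linarith [hs t]
    · obtain ⟨x, hx⟩ := ivt (Real.pi / 2 + Real.pi)
        (Set.mem_uIcc.2 (Or.inl ⟨by linarith, by linarith⟩))
      have := hs x
      rw [hx, Real.sin_add_pi, Real.sin_pi_div_two] at this
      linarith

lemma splits_of {p : ℝ[X]} (h0 : p ≠ 0) (h : RealRooted p) : p.Splits := by
  have h := h.resolve_left h0
  refine Polynomial.Splits.of_splits_map (algebraMap ℝ ℂ) (IsAlgClosed.splits _) fun a ha => ?_
  rw [mem_roots', IsRoot.def, eval_map_algebraMap] at ha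
  have := h a ha.2
  exact ⟨a.re, Complex.ext (by simp) (by simp [this])⟩

lemma aeval_prod {p : ℝ[X]} (hp : p.Splits) (z : ℂ) :
    aeval z p = (p.leadingCoeff : ℂ) * (p.roots.map fun a : ℝ => z - (a : ℂ)).prod := by
  conv_lhs => rw [hp.eq_prod_roots]
  rw [map_mul, aeval_C, ← Multiset.prod_hom_rel (r := fun q c => aeval z q = c)
    (f := fun a => X - C a) (g := fun a : ℝ => z - (a : ℂ))]
  · rfl
  · simp
  · intro a b c h; simp [h]

lemma count_of {p q : ℝ[X]} (hp : p.Splits) (hq : q.Splits) (lp : 0 < p.leadingCoeff)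
    (lq : 0 < q.leadingCoeff) (h : ∀ z : ℂ, 0 < z.im → MM z (aeval z p) (aeval z q))
    (t : ℝ) (tp : t ∉ p.roots) (tq : t ∉ q.roots) :
    Multiset.countP (fun a => t < a) p.roots ≤ Multiset.countP (fun a => t < a) q.roots ∧
    Multiset.countP (fun a => t < a) q.roots ≤ Multiset.countP (fun a => t < a) p.roots + 1 := by
  have hpi := Real.pi_pos
  have key : ∀ e > 0, ∀ t, 0 ≤ th q.roots t e - th p.roots t e ∧
      th q.roots t e - th p.roots t e ≤ Real.pi := by
    intro e he
    refine sin_conn (fun t => th q.roots t e - th p.roots t e)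
      ((th_cont _ _).sub (th_cont _ _)) ?_ ?_
    · simpa using (th_top q.roots e he).sub (th_top p.roots e he)
    · intro t
      have h1 := (h ((t : ℂ) + e * Complex.I) (by simpa using he)).1
      obtain ⟨r, hr, e1⟩ := th_spec p.roots t e he
      obtain ⟨s, hs, e2⟩ := th_spec q.roots t e he
      rw [aeval_prod hp, aeval_prod hq, e1, e2] at h1
      have e3 : (q.leadingCoeff : ℂ) * (s * Complex.exp (th q.roots t e * Complex.I)) *
          (starRingEnd ℂ) ((p.leadingCoeff : ℂ) * (r * Complex.exp (th p.roots t e * Complex.I)))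
          = ((q.leadingCoeff * s * p.leadingCoeff * r : ℝ) : ℂ) *
            Complex.exp (((th q.roots t e - th p.roots t e : ℝ) : ℂ) * Complex.I) := by
        rw [map_mul, map_mul, ← Complex.exp_conj, map_mul, Complex.conj_ofReal,
          Complex.conj_ofReal, Complex.conj_ofReal, Complex.conj_I]
        have : ((th q.roots t e - th p.roots t e : ℝ) : ℂ) * Complex.I
            = th q.roots t e * Complex.I + th p.roots t e * -Complex.I := by push_cast; ring
        rw [this, Complex.exp_add]
        push_cast
        ring
      rw [e3, Complex.im_ofReal_mul, Complex.exp_ofReal_mul_I_im] at h1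
      exact nonneg_of_mul_nonneg_right h1 (by positivity)
  have lim := (th_zero q.roots t tq).sub (th_zero p.roots t tp)
  have l1 := ge_of_tendsto lim (Filter.eventually_of_mem self_mem_nhdsWithin
    fun e he => (key e he t).1)
  have l2 := le_of_tendsto lim (Filter.eventually_of_mem self_mem_nhdsWithin
    fun e he => (key e he t).2)
  constructor
  · have : (Multiset.countP (fun a => t < a) p.roots : ℝ) ≤
      Multiset.countP (fun a => t < a) q.roots := by nlinarith
    exact_mod_cast this
  · have : (Multiset.countP (fun a => t < a) q.roots : ℝ) ≤
      Multiset.countP (fun a => t < a) p.roots + 1 := by nlinarith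
    exact_mod_cast this

lemma exists_between_notMem (R : Multiset ℝ) (a b : ℝ) (hab : a < b) :
    ∃ t, a < t ∧ t < b ∧ t ∉ R := by
  obtain ⟨t, ht, h⟩ := (Set.Ioo_infinite hab).exists_notMem_finset R.toFinset
  exact ⟨t, ht.1, ht.2, by simpa using h⟩

lemma rootsDesc_pairwise (p : ℝ[X]) : (rootsDesc p).Pairwise (· ≥ ·) := by
  unfold rootsDesc
  rw [List.pairwise_reverse]
  exact Multiset.pairwise_sort _ _

lemma rootsDesc_coe (p : ℝ[X]) : (rootsDesc p : Multiset ℝ) = p.roots := by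
  unfold rootsDesc
  rw [← Multiset.coe_reverse, List.reverse_reverse]
  exact Multiset.sort_eq _ _

lemma countP_ge {L : List ℝ} (hL : L.Pairwise (· ≥ ·)) (i : ℕ) (hi : i < L.length) (t : ℝ)
    (h : t < L[i]) : i + 1 ≤ L.countP (fun a => decide (t < a)) := by
  have h1 : (L.take (i + 1)).countP (fun a => decide (t < a)) = (L.take (i + 1)).length := by
    rw [List.countP_eq_length]
    intro a ha
    obtain ⟨j, hj, rfl⟩ := List.mem_iff_getElem.1 ha
    rw [List.length_take] at hj
    rw [List.getElem_take]
    have : L[i] ≤ L[j]'(by omega) := by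
      rcases (show j < i ∨ j = i by omega) with hji | rfl
      · exact List.pairwise_iff_getElem.1 hL j i _ _ hji
      · exact le_rfl
    exact decide_eq_true (lt_of_lt_of_le h this)
  have h2 := (List.take_sublist (i + 1) L).countP_le (p := fun a => decide (t < a))
  rw [h1, List.length_take] at h2
  omega

lemma countP_le {L : List ℝ} (hL : L.Pairwise (· ≥ ·)) (i : ℕ) (hi : i < L.length) (t : ℝ)
    (h : L[i] < t) : L.countP (fun a => decide (t < a)) ≤ i := by
  conv_lhs => rw [← List.take_append_drop i L]
  rw [List.countP_append]
  have h1 : (L.drop i).countP (fun a => decide (t < a)) = 0 := by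
    rw [List.countP_eq_zero]
    intro a ha
    obtain ⟨j, hj, rfl⟩ := List.mem_iff_getElem.1 ha
    rw [List.length_drop] at hj
    rw [List.getElem_drop]
    have : L[i + j]'(by omega) ≤ L[i] := by
      rcases Nat.eq_zero_or_pos j with rfl | hji
      · exact le_rfl
      · exact List.pairwise_iff_getElem.1 hL i (i + j) _ _ (by omega)
    simp only [decide_eq_true_eq, not_lt]
    linarith
  have h2 := List.countP_le_length (p := fun a => decide (t < a)) (l := L.take i)
  rw [List.length_take] at h2
  omega

lemma interlaces_of {p q : ℝ[X]} (hp0 : RealRooted p) (hq0 : RealRooted q)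
    (lp : p ≠ 0 → 0 < p.leadingCoeff)
    (lq : q ≠ 0 → 0 < q.leadingCoeff)
    (h : ∀ z : ℂ, 0 < z.im → MM z (aeval z p) (aeval z q)) : Interlaces p q := by
  by_cases hp : p = 0
  · exact Or.inl ⟨hp, hq0⟩
  by_cases hq : q = 0
  · exact Or.inr (Or.inl ⟨hq, hp0⟩)
  have cnt := count_of (splits_of hp hp0) (splits_of hq hq0) (lp hp) (lq hq) h
  have cp : ∀ t, Multiset.countP (fun a => t < a) p.roots
      = (rootsDesc p).countP (fun a => decide (t < a)) := by
    intro t; rw [← rootsDesc_coe p, Multiset.coe_countP]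
  have cq : ∀ t, Multiset.countP (fun a => t < a) q.roots
      = (rootsDesc q).countP (fun a => decide (t < a)) := by
    intro t; rw [← rootsDesc_coe q, Multiset.coe_countP]
  have card : Multiset.card p.roots ≤ Multiset.card q.roots ∧
      Multiset.card q.roots ≤ Multiset.card p.roots + 1 := by
    obtain ⟨t, ht⟩ : ∃ t, ∀ a ∈ p.roots + q.roots, t < a := by
      obtain ⟨m, hm⟩ := (p.roots + q.roots).toFinset.bddBelow
      refine ⟨m - 1, fun a ha => ?_⟩
      have : m ≤ a := hm (by simpa using ha)
      linarith
    have hp' : ∀ a ∈ p.roots, t < a := fun a ha => ht a (Multiset.mem_add.2 (Or.inl ha))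
    have hq' : ∀ a ∈ q.roots, t < a := fun a ha => ht a (Multiset.mem_add.2 (Or.inr ha))
    have := cnt t (fun hh => lt_irrefl _ (hp' t hh)) (fun hh => lt_irrefl _ (hq' t hh))
    rw [Multiset.countP_eq_card.2 hp', Multiset.countP_eq_card.2 hq'] at this
    exact this
  refine Or.inr (Or.inr ⟨hp0, hq0, card.2, card.1, ?_, ?_⟩)
  · intro i h1 h2
    by_contra hlt
    push Not at hlt
    obtain ⟨t, ta, tb, tn⟩ := exists_between_notMem (p.roots + q.roots) _ _ hlt
    rw [Multiset.mem_add, not_or] at tn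
    have c := cnt t tn.1 tn.2
    rw [cp, cq] at c
    have := countP_ge (rootsDesc_pairwise p) i h1 t (by simpa using tb)
    have := countP_le (rootsDesc_pairwise q) i h2 t (by simpa using ta)
    omega
  · intro i h1 h2
    by_contra hlt
    push Not at hlt
    obtain ⟨t, ta, tb, tn⟩ := exists_between_notMem (p.roots + q.roots) _ _ hlt
    rw [Multiset.mem_add, not_or] at tn
    have c := cnt t tn.1 tn.2
    rw [cp, cq] at c
    have := countP_ge (rootsDesc_pairwise q) (i + 1) h1 t (by simpa using tb)
    have := countP_le (rootsDesc_pairwise p) i h2 t (by simpa using ta)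
    omega

lemma realRooted_of {p : ℝ[X]} (h : ∀ z : ℂ, 0 < z.im → aeval z p = 0 → p = 0) :
    RealRooted p := by
  by_cases hp : p = 0
  · exact Or.inl hp
  refine Or.inr fun z hz => ?_
  rcases lt_trichotomy z.im 0 with h1 | h1 | h1
  · refine absurd (h ((starRingEnd ℂ) z) (by simpa using h1) ?_) hp
    rw [aeval_conj, hz, map_zero]
  · exact h1
  · exact absurd (h z h1 hz) hp

lemma ppoly_lc (n k : ℕ) (T : Finset ℕ) (h : ppoly n k T ≠ 0) :
    0 < (ppoly n k T).leadingCoeff :=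
  lt_of_le_of_ne (ppoly_coeff_nonneg n k T _) (Ne.symm (leadingCoeff_ne_zero.2 h))

/-- For every `n ∈ ℕ` and every `T ⊆ [n]`, the sequence
`(p^T_{n,0}, p^T_{n,1}, …, p^T_{n,n})` is an interlacing sequence of real-rooted
polynomials. -/
theorem stmt1 (n : ℕ) (T : Finset ℕ) (hT : T ⊆ Finset.Icc 1 n) :
    (∀ k ≤ n, RealRooted (ppoly n k T)) ∧
    (∀ i j : ℕ, i < j → j ≤ n → Interlaces (ppoly n i T) (ppoly n j T)) := by
  have rr : ∀ k ≤ n, RealRooted (ppoly n k T) := fun k hk =>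
    realRooted_of fun z hz h0 => (ppoly_main n T z hz).1 k hk h0
  refine ⟨rr, fun i j hij hj => ?_⟩
  exact interlaces_of (rr i (by omega)) (rr j hj) (ppoly_lc n i T) (ppoly_lc n j T)
    fun z hz => (ppoly_main n T z hz).2 i j hij (by omega)
end
end

section
/- Let n ≥ 2 and T = {2, 4, ..., 2n-2} ⊆ [2n-1], and let N = #{w ∈ S_{2n} : Des(w) ⊆ T} (permutations of [2n] with an ascent in every odd position). Then Σ_{w ∈ S_{2n} : Des(w) ⊆ T} des(w) = N · 5(n-1)/6, and Σ_{w ∈ S_{2n} : Des(w) ⊆ T} (des(w) − 5(n-1)/6)^2 = N · (19n − 13)/180. -/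
open Polynomial

open scoped Classical

noncomputable section

/-- values as a function on naturals -/
def wv {m : ℕ} (w : Equiv.Perm (Fin m)) (i : ℕ) : ℕ :=
  if h : i < m then (w ⟨i, h⟩ : ℕ) else i

def asc {m : ℕ} (w : Equiv.Perm (Fin m)) (i : ℕ) : Prop := wv w i < wv w (i + 1)

def blk {m : ℕ} (a k : ℕ) (h : a + k ≤ m) : Fin k ↪ Fin m :=
  ⟨fun j => ⟨a + j, by omega⟩, fun x y hxy => by
    simp only [Fin.mk.injEq] at hxy
    ext; omega⟩

lemma strictMono_blk {m : ℕ} (a k : ℕ) (h : a + k ≤ m) (w : Equiv.Perm (Fin m)) :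
    StrictMono (w ∘ blk a k h) ↔ ∀ j, j + 1 < k → asc w (a + j) := by
  cases k with
  | zero => 
    constructor
    · intro _ j hj; omega
    · intro _ x; exact x.elim0
  | succ k =>
    rw [Fin.strictMono_iff_lt_succ]
    constructor
    · intro H j hj
      have := H ⟨j, by omega⟩
      simp only [blk, Function.comp, Fin.lt_def] at this
      have h1 : a + j < m := by omega
      have h2 : a + j + 1 < m := by omega
      simp only [asc, wv, h1, h2, dif_pos]
      exact this
    · intro H j
      have := H j (by omega)
      have h1 : a + j < m := by omega
      have h2 : a + j + 1 < m := by omega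
      simp only [asc, wv, h1, h2, dif_pos] at this
      exact this

lemma exists_unique_sort {m k : ℕ} (f : Fin k → Fin m) (hf : Function.Injective f) :
    (Finset.univ.filter (fun σ : Equiv.Perm (Fin k) => StrictMono (f ∘ σ))).card = 1 := by
  rw [Finset.card_eq_one]
  refine ⟨Tuple.sort f, ?_⟩
  ext σ
  simp only [Finset.mem_filter, Finset.mem_univ, true_and, Finset.mem_singleton]
  constructor
  · intro h
    have := Tuple.unique_monotone (f := f) h.monotone (Tuple.monotone_sort f)
    ext x
    have := congrFun this x
    exact congrArg _ (hf this)
  · rintro rfl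
    exact (Tuple.monotone_sort f).strictMono_of_injective (hf.comp (Equiv.injective _))

def BInv {m : ℕ} (P : Equiv.Perm (Fin m) → Prop) (a k : ℕ) : Prop :=
  ∀ w w' : Equiv.Perm (Fin m), (∀ i, (i < a ∨ a + k ≤ i) → wv w i = wv w' i) → P w → P w'

def cnt {m : ℕ} (P : Equiv.Perm (Fin m) → Prop) : ℕ := (Finset.univ.filter P).card

lemma cnt_congr {m : ℕ} {P Q : Equiv.Perm (Fin m) → Prop} (h : ∀ w, P w ↔ Q w) :
    cnt P = cnt Q := by
  have : P = Q := funext fun w => propext (h w)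
  rw [this]

lemma wv_via {m : ℕ} (a k : ℕ) (h : a + k ≤ m) (w : Equiv.Perm (Fin m))
    (σ : Equiv.Perm (Fin k)) (i : ℕ) (hi : i < a ∨ a + k ≤ i) :
    wv (w * σ.viaEmbedding (blk a k h)) i = wv w i := by
  unfold wv
  split_ifs with hm
  · rw [Equiv.Perm.mul_apply, Equiv.Perm.viaEmbedding_apply_of_notMem]
    rintro ⟨j, hj⟩
    have hj : a + (j : ℕ) = i := congrArg Fin.val hj
    omega
  · rfl

lemma block_count {m : ℕ} (P : Equiv.Perm (Fin m) → Prop) (a k : ℕ) (h : a + k ≤ m)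
    (hP : BInv P a k) :
    cnt (fun w => P w ∧ ∀ j, j + 1 < k → asc w (a + j)) * k.factorial = cnt P := by
  have hinv : ∀ (σ : Equiv.Perm (Fin k)) w, P (w * σ.viaEmbedding (blk a k h)) ↔ P w := by
    intro σ w
    constructor
    · exact hP _ _ (fun i hi => wv_via a k h w σ i hi)
    · exact hP _ _ (fun i hi => (wv_via a k h w σ i hi).symm)
  have h1 : ∀ σ : Equiv.Perm (Fin k),
      cnt (fun w => P w ∧ ∀ j, j + 1 < k → asc w (a + j)) =
      ∑ w : Equiv.Perm (Fin m), if P w ∧ StrictMono ((w ∘ blk a k h) ∘ σ) then 1 else 0 := by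
    intro σ
    rw [cnt, Finset.card_filter]
    refine (Fintype.sum_equiv (Equiv.mulRight (σ.viaEmbedding (blk a k h))) _ _ ?_).symm
    intro w
    have e : ((w * σ.viaEmbedding (blk a k h)) ∘ blk a k h) = (w ∘ blk a k h) ∘ σ := by
      funext x
      simp [Equiv.Perm.viaEmbedding_apply]
    simp only [Equiv.coe_mulRight, hinv, ← strictMono_blk a k h, ← e]
  calc _ = ∑ σ : Equiv.Perm (Fin k), cnt (fun w => P w ∧ ∀ j, j + 1 < k → asc w (a + j)) := by
        simp [Fintype.card_perm, mul_comm]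
    _ = ∑ w : Equiv.Perm (Fin m), ∑ σ : Equiv.Perm (Fin k),
          if P w ∧ StrictMono ((w ∘ blk a k h) ∘ σ) then 1 else 0 := by
        rw [Finset.sum_comm]
        exact Finset.sum_congr rfl fun σ _ => h1 σ
    _ = cnt P := by
        rw [cnt, Finset.card_filter]
        refine Finset.sum_congr rfl fun w _ => ?_
        by_cases hp : P w
        · simp only [hp, true_and, if_true]
          rw [← Finset.card_filter]
          exact exists_unique_sort _ (w.injective.comp (blk a k h).injective)
        · simp [hp]

lemma BInv_and {m : ℕ} {P Q : Equiv.Perm (Fin m) → Prop} {a k : ℕ} (hP : BInv P a k)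
    (hQ : BInv Q a k) : BInv (fun w => P w ∧ Q w) a k :=
  fun w w' h hh => ⟨hP w w' h hh.1, hQ w w' h hh.2⟩

lemma BInv_asc {m : ℕ} {a k j : ℕ} (h : j + 1 < a ∨ a + k ≤ j) :
    BInv (fun w : Equiv.Perm (Fin m) => asc w j) a k := by
  intro w w' hw hh
  simp only [asc] at *
  rw [← hw j (by omega), ← hw (j+1) (by omega)]; exact hh

lemma BInv_mono {m : ℕ} {P : Equiv.Perm (Fin m) → Prop} {a k a' k' : ℕ} (hP : BInv P a k)
    (h1 : a ≤ a') (h2 : a' + k' ≤ a + k) : BInv P a' k' :=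
  fun w w' h hh => hP w w' (fun i hi => h i (by omega)) hh

lemma BInv_others {m : ℕ} (n i t a k : ℕ) (h1 : 2 * i ≤ a) (h2 : a + k ≤ 2 * (i + t)) :
    BInv (fun w : Equiv.Perm (Fin m) => ∀ l < n, (l < i ∨ i + t ≤ l) → asc w (2 * l)) a k := by
  intro w w' h hh l hl hl'
  exact BInv_asc (a := a) (k := k) (by omega) w w' h (hh l hl hl')

def Sp {m : ℕ} (n : ℕ) (w : Equiv.Perm (Fin m)) : Prop := ∀ l < n, asc w (2 * l)

lemma pair_count {m : ℕ} (P : Equiv.Perm (Fin m) → Prop) (a : ℕ) (h : a + 2 ≤ m)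
    (hP : BInv P a 2) : cnt (fun w => P w ∧ asc w a) * 2 = cnt P := by
  rw [← block_count P a 2 h hP, Nat.factorial_two]
  congr 1
  apply cnt_congr
  intro w
  refine and_congr_right fun _ => ⟨fun H j hj => ?_, fun H => H 0 (by omega)⟩
  obtain rfl : j = 0 := by omega
  exact H

lemma six (n i : ℕ) (hi : i + 1 < n) (R : Equiv.Perm (Fin (2 * n)) → Prop)
    (hR : BInv R (2 * i) 4) :
    cnt (fun w => (Sp n w ∧ R w) ∧ asc w (2 * i + 1)) * 6 = cnt (fun w => Sp n w ∧ R w) := by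
  have hP : BInv (fun w => (∀ l < n, (l < i ∨ i + 2 ≤ l) → asc w (2 * l)) ∧ R w) (2 * i) 4 :=
    BInv_and (BInv_others n i 2 _ _ (by omega) (by omega)) hR
  have e1 := block_count _ (2 * i) 4 (by omega) hP
  have e2 := pair_count _ (2 * i) (by omega) (BInv_mono (a' := 2 * i) (k' := 2) hP (by omega) (by omega))
  have e3 := pair_count _ (2 * i + 2) (by omega)
    (BInv_and (BInv_mono (a' := 2 * i + 2) (k' := 2) hP (by omega) (by omega))
      (BInv_asc (j := 2 * i) (by omega)))
  have c1 : cnt (fun w => (Sp n w ∧ R w) ∧ asc w (2 * i + 1)) = cnt (fun w =>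
      ((∀ l < n, (l < i ∨ i + 2 ≤ l) → asc w (2 * l)) ∧ R w) ∧
        ∀ j, j + 1 < 4 → asc w (2 * i + j)) := by
    apply cnt_congr
    intro w
    constructor
    · rintro ⟨⟨h1, h2⟩, h3⟩
      refine ⟨⟨fun l hl _ => h1 l hl, h2⟩, fun j hj => ?_⟩
      obtain rfl | rfl | rfl : j = 0 ∨ j = 1 ∨ j = 2 := by omega
      · exact h1 i (by omega)
      · exact h3
      · exact h1 (i + 1) (by omega)
    · rintro ⟨⟨h1, h2⟩, h3⟩
      refine ⟨⟨fun l hl => ?_, h2⟩, h3 1 (by omega)⟩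
      by_cases hl' : l < i ∨ i + 2 ≤ l
      · exact h1 l hl hl'
      obtain rfl | rfl : l = i ∨ l = i + 1 := by omega
      · exact h3 0 (by omega)
      · exact h3 2 (by omega)
  have c2 : cnt (fun w => Sp n w ∧ R w) = cnt (fun w =>
      (((∀ l < n, (l < i ∨ i + 2 ≤ l) → asc w (2 * l)) ∧ R w) ∧ asc w (2 * i)) ∧
        asc w (2 * i + 2)) := by
    apply cnt_congr
    intro w
    constructor
    · rintro ⟨h1, h2⟩
      exact ⟨⟨⟨fun l hl _ => h1 l hl, h2⟩, h1 i (by omega)⟩, h1 (i + 1) (by omega)⟩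
    · rintro ⟨⟨⟨h1, h2⟩, h3⟩, h4⟩
      refine ⟨fun l hl => ?_, h2⟩
      by_cases hl' : l < i ∨ i + 2 ≤ l
      · exact h1 l hl hl'
      obtain rfl | rfl : l = i ∨ l = i + 1 := by omega
      · exact h3
      · exact h4
  rw [c1, c2]
  simp only [show Nat.factorial 4 = 24 from rfl] at e1
  omega

lemma ninety (n i : ℕ) (hi : i + 2 < n) :
    cnt (fun w : Equiv.Perm (Fin (2 * n)) =>
      (Sp n w ∧ asc w (2 * i + 1)) ∧ asc w (2 * (i + 1) + 1)) * 90 =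
    cnt (fun w : Equiv.Perm (Fin (2 * n)) => Sp n w) := by
  have hP : BInv (fun w : Equiv.Perm (Fin (2 * n)) =>
      (∀ l < n, (l < i ∨ i + 3 ≤ l) → asc w (2 * l))) (2 * i) 6 :=
    BInv_others n i 3 _ _ (by omega) (by omega)
  have e1 := block_count _ (2 * i) 6 (by omega) hP
  have e2 := pair_count _ (2 * i) (by omega) (BInv_mono (a' := 2 * i) (k' := 2) hP (by omega) (by omega))
  have e3 := pair_count _ (2 * i + 2) (by omega)
    (BInv_and (BInv_mono (a' := 2 * i + 2) (k' := 2) hP (by omega) (by omega))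
      (BInv_asc (j := 2 * i) (by omega)))
  have e4 := pair_count _ (2 * i + 4) (by omega)
    (BInv_and (BInv_and (BInv_mono (a' := 2 * i + 4) (k' := 2) hP (by omega) (by omega))
      (BInv_asc (j := 2 * i) (by omega))) (BInv_asc (j := 2 * i + 2) (by omega)))
  have c1 : cnt (fun w : Equiv.Perm (Fin (2 * n)) =>
      (Sp n w ∧ asc w (2 * i + 1)) ∧ asc w (2 * (i + 1) + 1)) = cnt (fun w : Equiv.Perm (Fin (2 * n)) =>
      (∀ l < n, (l < i ∨ i + 3 ≤ l) → asc w (2 * l)) ∧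
        ∀ j, j + 1 < 6 → asc w (2 * i + j)) := by
    apply cnt_congr
    intro w
    constructor
    · rintro ⟨⟨h1, h2⟩, h3⟩
      refine ⟨fun l hl _ => h1 l hl, fun j hj => ?_⟩
      obtain rfl | rfl | rfl | rfl | rfl : j = 0 ∨ j = 1 ∨ j = 2 ∨ j = 3 ∨ j = 4 := by omega
      · exact h1 i (by omega)
      · exact h2
      · exact h1 (i + 1) (by omega)
      · exact h3
      · exact h1 (i + 2) (by omega)
    · rintro ⟨h1, h3⟩
      refine ⟨⟨fun l hl => ?_, h3 1 (by omega)⟩, h3 3 (by omega)⟩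
      by_cases hl' : l < i ∨ i + 3 ≤ l
      · exact h1 l hl hl'
      obtain rfl | rfl | rfl : l = i ∨ l = i + 1 ∨ l = i + 2 := by omega
      · exact h3 0 (by omega)
      · exact h3 2 (by omega)
      · exact h3 4 (by omega)
  have c2 : cnt (fun w : Equiv.Perm (Fin (2 * n)) => Sp n w) = cnt (fun w : Equiv.Perm (Fin (2 * n)) =>
      (((∀ l < n, (l < i ∨ i + 3 ≤ l) → asc w (2 * l)) ∧ asc w (2 * i)) ∧
        asc w (2 * i + 2)) ∧ asc w (2 * i + 4)) := by
    apply cnt_congr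
    intro w
    constructor
    · intro h1
      exact ⟨⟨⟨fun l hl _ => h1 l hl, h1 i (by omega)⟩, h1 (i + 1) (by omega)⟩,
        h1 (i + 2) (by omega)⟩
    · rintro ⟨⟨⟨h1, h2⟩, h3⟩, h4⟩
      intro l hl
      by_cases hl' : l < i ∨ i + 3 ≤ l
      · exact h1 l hl hl'
      obtain rfl | rfl | rfl : l = i ∨ l = i + 1 ∨ l = i + 2 := by omega
      · exact h2
      · exact h3
      · exact h4
  rw [c1, c2]
  simp only [show Nat.factorial 6 = 720 from rfl] at e1
  omega

lemma single (n i : ℕ) (hi : i + 1 < n) :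
    cnt (fun w : Equiv.Perm (Fin (2 * n)) => Sp n w ∧ asc w (2 * i + 1)) * 6 =
    cnt (fun w : Equiv.Perm (Fin (2 * n)) => Sp n w) := by
  have := six n i hi (fun _ => True) (fun _ _ _ _ => trivial)
  simpa only [and_true] using this

lemma far (n i j : ℕ) (hi : i + 1 < n) (hj : j + 1 < n) (h : i + 2 ≤ j ∨ j + 2 ≤ i) :
    cnt (fun w : Equiv.Perm (Fin (2 * n)) =>
      (Sp n w ∧ asc w (2 * i + 1)) ∧ asc w (2 * j + 1)) * 36 =
    cnt (fun w : Equiv.Perm (Fin (2 * n)) => Sp n w) := by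
  have h1 := six n j hj (fun w => asc w (2 * i + 1)) (BInv_asc (by omega))
  have h2 := single n i hi
  omega

/-- indicator of an ascent in the `i`-th even position -/
def ind {m : ℕ} (w : Equiv.Perm (Fin m)) (i : ℕ) : ℝ := if asc w (2 * i + 1) then 1 else 0

lemma sum_ind (n i : ℕ) (hi : i + 1 < n) :
    ∑ w ∈ Finset.univ.filter (fun w : Equiv.Perm (Fin (2 * n)) => Sp n w), ind w i =
    cnt (fun w : Equiv.Perm (Fin (2 * n)) => Sp n w) / 6 := by
  rw [← single n i hi]
  simp only [ind, Finset.sum_boole, Finset.filter_filter, cnt]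
  push_cast
  ring

lemma sum_ind2 (n i j : ℕ) (hi : i + 1 < n) (hj : j + 1 < n) :
    ∑ w ∈ Finset.univ.filter (fun w : Equiv.Perm (Fin (2 * n)) => Sp n w), ind w i * ind w j =
    cnt (fun w : Equiv.Perm (Fin (2 * n)) => Sp n w) *
      (1 / 36 + (if i = j then 5 / 36 else 0) - (if j = i + 1 then 1 / 60 else 0)
        - (if i = j + 1 then 1 / 60 else 0)) := by
  have key : ∑ w ∈ Finset.univ.filter (fun w : Equiv.Perm (Fin (2 * n)) => Sp n w),
      ind w i * ind w j = (cnt (fun w : Equiv.Perm (Fin (2 * n)) =>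
      (Sp n w ∧ asc w (2 * i + 1)) ∧ asc w (2 * j + 1)) : ℝ) := by
    simp only [ind, cnt, ← ite_and, ite_mul, one_mul, zero_mul, Finset.sum_boole,
      Finset.filter_filter, and_assoc]
  rw [key]
  rcases lt_trichotomy i j with h | rfl | h
  · rcases eq_or_lt_of_le (Nat.succ_le_of_lt h) with rfl | h'
    · have := ninety n i (by omega)
      rw [← this]
      rw [if_neg (by omega), if_pos rfl, if_neg (by omega)]
      push_cast; ring
    · rw [← far n i j hi hj (by omega)]
      rw [if_neg (by omega), if_neg (by omega), if_neg (by omega)]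
      push_cast; ring
  · rw [← single n i hi]
    simp only [and_assoc, and_self]
    simp; ring
  · rcases eq_or_lt_of_le (Nat.succ_le_of_lt h) with rfl | h'
    · have := ninety n j (by omega)
      rw [← this]
      rw [cnt_congr (Q := fun w : Equiv.Perm (Fin (2 * n)) =>
      (Sp n w ∧ asc w (2 * j + 1)) ∧ asc w (2 * (j + 1) + 1)) (fun w => by
        rw [and_assoc, and_assoc, and_comm (a := asc w (2 * j + 1))])]
      rw [if_neg (by omega), if_neg (by omega), if_pos rfl]
      push_cast; ring
    · rw [← far n i j hi hj (by omega)]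
      rw [if_neg (by omega), if_neg (by omega), if_neg (by omega)]
      push_cast; ring

lemma cov_sum (m : ℕ) : ∑ i ∈ Finset.range (m + 1), ∑ j ∈ Finset.range (m + 1),
    ((if i = j then (5 / 36 : ℝ) else 0) - (if j = i + 1 then 1 / 60 else 0)
        - (if i = j + 1 then 1 / 60 else 0)) = 5 * (m + 1) / 36 - m / 30 := by
  have h2 : ∀ m : ℕ, ∑ i ∈ Finset.range (m + 1),
      (if i + 1 ∈ Finset.range (m + 1) then (1 / 60 : ℝ) else 0) = m / 60 := by
    intro m
    rw [Finset.sum_range_succ, if_neg (by simp), Finset.sum_congr rfl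
      (g := fun _ => (1 / 60 : ℝ)) (fun i hi => if_pos (by
        simp only [Finset.mem_range] at *; omega))]
    simp; ring
  simp only [Finset.sum_sub_distrib]
  rw [Finset.sum_comm (f := fun i j => if i = j + 1 then (1 / 60 : ℝ) else 0)]
  simp only [Finset.sum_ite_eq, Finset.sum_ite_eq', h2]
  rw [Finset.sum_congr rfl (g := fun _ => (5 / 36 : ℝ)) (fun i hi => if_pos hi)]
  simp; ring

lemma mem_descSet_s10 {m : ℕ} (w : Equiv.Perm (Fin m)) (x : ℕ) :
    x ∈ descSet w ↔ ∃ i, i + 1 < m ∧ x = i + 1 ∧ ¬ asc w i := by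
  simp only [descSet, Finset.mem_image, Finset.mem_filter, Finset.mem_univ, true_and]
  have key : ∀ i (h : i + 1 < m), ¬ asc w i ↔ w ⟨i + 1, h⟩ < w ⟨i, by omega⟩ := by
    intro i h
    have h' : i < m := by omega
    simp only [asc, wv, h, h', dif_pos, not_lt, Fin.lt_def]
    have : w ⟨i + 1, h⟩ ≠ w ⟨i, h'⟩ := fun e => by
      have := w.injective e
      simp at this
    have : (w ⟨i + 1, h⟩ : ℕ) ≠ w ⟨i, h'⟩ := fun e => this (Fin.ext e)
    omega
  constructor
  · rintro ⟨i, h, rfl⟩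
    exact ⟨i, by omega, rfl, (key i (by omega)).2 h⟩
  · rintro ⟨i, h, rfl, h'⟩
    exact ⟨⟨i, by omega⟩, (key i h).1 h', rfl⟩

lemma sub_iff (n : ℕ) (w : Equiv.Perm (Fin (2 * n))) :
    descSet w ⊆ (Finset.Icc 1 (n - 1)).image (fun i => 2 * i) ↔ Sp n w := by
  constructor
  · intro h l hl
    by_contra hc
    have := h ((mem_descSet_s10 w (2 * l + 1)).2 ⟨2 * l, by omega, rfl, hc⟩)
    simp only [Finset.mem_image] at this
    obtain ⟨i, _, hi⟩ := this
    omega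
  · intro h x hx
    obtain ⟨i, hi, rfl, hc⟩ := (mem_descSet_s10 w x).1 hx
    simp only [Finset.mem_image, Finset.mem_Icc]
    rcases Nat.even_or_odd' i with ⟨l, rfl | rfl⟩
    · exact absurd (h l (by omega)) hc
    · exact ⟨l + 1, by omega, by omega⟩

lemma card_desc (n : ℕ) (hn : 1 ≤ n) (w : Equiv.Perm (Fin (2 * n))) (hw : Sp n w) :
    ((descSet w).card : ℝ) = (n - 1 : ℝ) - ∑ i ∈ Finset.range (n - 1), ind w i := by
  have : descSet w = ((Finset.range (n - 1)).filter (fun i => ¬ asc w (2 * i + 1))).image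
      (fun i => 2 * i + 2) := by
    ext x
    rw [mem_descSet_s10]
    simp only [Finset.mem_image, Finset.mem_filter, Finset.mem_range]
    constructor
    · rintro ⟨i, hi, rfl, hc⟩
      rcases Nat.even_or_odd' i with ⟨l, rfl | rfl⟩
      · exact absurd (hw l (by omega)) hc
      · exact ⟨l, ⟨by omega, hc⟩, by omega⟩
    · rintro ⟨l, ⟨hl, hc⟩, rfl⟩
      exact ⟨2 * l + 1, by omega, rfl, hc⟩
  rw [this, Finset.card_image_of_injective _ (fun a b (h : 2 * a + 2 = 2 * b + 2) => by omega)]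
  have h1 := Finset.card_filter_add_card_filter_not (s := Finset.range (n - 1))
    (fun i => asc w (2 * i + 1))
  simp only [ind, Finset.sum_boole]
  have h2 : ((n - 1 : ℕ) : ℝ) = n - 1 := by push_cast [hn]; ring
  rw [← h2, eq_sub_iff_add_eq]
  rw [Finset.card_range] at h1
  exact_mod_cast (by omega)

/-- Let `n ≥ 2`, `T = {2, 4, …, 2n-2} ⊆ [2n-1]`, and
`N = #{w ∈ S_{2n} : Des(w) ⊆ T}`.  Then `Σ_{w : Des(w) ⊆ T} des(w) = N·5(n-1)/6` and
`Σ_{w : Des(w) ⊆ T} (des(w) - 5(n-1)/6)² = N·(19n-13)/180`. -/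
theorem stmt10 (n : ℕ) (hn : 2 ≤ n) (T : Finset ℕ)
    (hT : T = (Finset.Icc 1 (n - 1)).image (fun i => 2 * i)) :
    (∑ w ∈ Finset.univ.filter (fun w : Equiv.Perm (Fin (2 * n)) => descSet w ⊆ T),
        ((descSet w).card : ℝ)) =
      ((Finset.univ.filter
          (fun w : Equiv.Perm (Fin (2 * n)) => descSet w ⊆ T)).card : ℝ) *
        (5 * ((n : ℝ) - 1) / 6) ∧
    (∑ w ∈ Finset.univ.filter (fun w : Equiv.Perm (Fin (2 * n)) => descSet w ⊆ T),
        (((descSet w).card : ℝ) - 5 * ((n : ℝ) - 1) / 6) ^ 2) =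
      ((Finset.univ.filter
          (fun w : Equiv.Perm (Fin (2 * n)) => descSet w ⊆ T)).card : ℝ) *
        ((19 * (n : ℝ) - 13) / 180) := by
  subst hT
  have hS : (Finset.univ.filter (fun w : Equiv.Perm (Fin (2 * n)) =>
      descSet w ⊆ (Finset.Icc 1 (n - 1)).image (fun i => 2 * i))) =
      Finset.univ.filter (fun w : Equiv.Perm (Fin (2 * n)) => Sp n w) :=
    Finset.filter_congr fun w _ => sub_iff n w
  rw [hS]
  have hN : ((Finset.univ.filter (fun w : Equiv.Perm (Fin (2 * n)) => Sp n w)).card : ℝ) =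
    (cnt (fun w : Equiv.Perm (Fin (2 * n)) => Sp n w) : ℝ) := rfl
  have h2 : ((n - 1 : ℕ) : ℝ) = n - 1 := by
    rw [Nat.cast_sub (by omega)]; simp
  have hd : ∀ w ∈ Finset.univ.filter (fun w : Equiv.Perm (Fin (2 * n)) => Sp n w),
      ((descSet w).card : ℝ) = (n - 1 : ℝ) - ∑ i ∈ Finset.range (n - 1), ind w i :=
    fun w hw => card_desc n (by omega) w (Finset.mem_filter.1 hw).2
  have s1 : ∑ w ∈ Finset.univ.filter (fun w : Equiv.Perm (Fin (2 * n)) => Sp n w),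
      ∑ i ∈ Finset.range (n - 1), ind w i =
      (cnt (fun w : Equiv.Perm (Fin (2 * n)) => Sp n w) : ℝ) * ((n - 1) / 6) := by
    rw [Finset.sum_comm, Finset.sum_congr rfl (fun i hi =>
      sum_ind n i (by rw [Finset.mem_range] at hi; omega))]
    rw [Finset.sum_const, Finset.card_range, nsmul_eq_mul, h2]; ring
  have s2 : ∑ w ∈ Finset.univ.filter (fun w : Equiv.Perm (Fin (2 * n)) => Sp n w),
      (∑ i ∈ Finset.range (n - 1), ind w i) ^ 2 =
      (cnt (fun w : Equiv.Perm (Fin (2 * n)) => Sp n w) : ℝ) *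
        (((n - 1) / 6) ^ 2 + (19 * n - 13) / 180) := by
    simp only [sq, Finset.sum_mul_sum]
    rw [Finset.sum_comm, Finset.sum_congr rfl (fun i _ => Finset.sum_comm)]
    rw [Finset.sum_congr rfl (fun i hi => Finset.sum_congr rfl (fun j hj =>
      sum_ind2 n i j (by rw [Finset.mem_range] at hi; omega)
        (by rw [Finset.mem_range] at hj; omega)))]
    simp only [← Finset.mul_sum]
    congr 1
    obtain ⟨k, rfl⟩ : ∃ k, n = k + 2 := ⟨n - 2, by omega⟩
    have := cov_sum k
    simp only [add_sub_assoc, Finset.sum_add_distrib] at this ⊢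
    simp only [show k + 2 - 1 = k + 1 from rfl]
    simp only [← add_sub_assoc, Finset.sum_sub_distrib] at this ⊢
    simp only [Finset.sum_const, Finset.card_range, nsmul_eq_mul]
    push_cast
    linarith
  constructor
  · rw [Finset.sum_congr rfl hd, Finset.sum_sub_distrib, s1, Finset.sum_const, nsmul_eq_mul, hN]
    ring
  · have : ∀ w ∈ Finset.univ.filter (fun w : Equiv.Perm (Fin (2 * n)) => Sp n w),
        (((descSet w).card : ℝ) - 5 * ((n : ℝ) - 1) / 6) ^ 2 =
        ((n - 1 : ℝ) / 6) ^ 2 - ((n - 1 : ℝ) / 3) * (∑ i ∈ Finset.range (n - 1), ind w i) +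
          (∑ i ∈ Finset.range (n - 1), ind w i) ^ 2 := by
      intro w hw
      rw [hd w hw]; ring
    rw [Finset.sum_congr rfl this, Finset.sum_add_distrib, Finset.sum_sub_distrib,
      ← Finset.mul_sum, s1, s2, Finset.sum_const, nsmul_eq_mul, hN]
    ring
end
end
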